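/- Let r >= 1 and N >= 1 be integers and let lambda_1 >= lambda_2 >= ... >= lambda_N >= 0 be integers (a partition with at most N parts, padded by zeros). Set h_i := lambda_i - i + N for i = 1,...,N, define p_{r+1}(lambda) := sum over i = 1,...,N of [ (lambda_i - i + 1/2)^{r+1} - (1/2 - i)^{r+1} ], and define the polynomial A_{r+1}(x) := sum over k = 0,...,r+1 of [ r! * (1/2 - N)^k / k! * x^{r+1-k}/(r+1-k)! + (-1)^{r+1} * r! * (-1)^k * B_k / k! * ((2^{k-1}-1)/2^{k-1}) * N^{r+1-k}/(r+2-k)! ], where B_k are the Bernoulli numbers (B_1 = -1/2). Then, as rational numbers, sum over i = 1,...,N of A_{r+1}(h_i) = p_{r+1}(lambda)/(r+1). -/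

import Mathlib

/-- The polynomial `A_{r+1}` of Equation (Eq:A):
`A_{r+1}(x) = ∑_{k=0}^{r+1} [ r! (1/2-N)^k/k! · x^{r+1-k}/(r+1-k)!
  + (-1)^{r+1} r! (-1)^k B_k/k! · ((2^{k-1}-1)/2^{k-1}) · N^{r+1-k}/(r+2-k)! ]`. -/
noncomputable def Apoly (r N : ℕ) (x : ℚ) : ℚ :=
  ∑ k ∈ Finset.range (r + 2),
    ((r.factorial : ℚ) * (1 / 2 - (N : ℚ)) ^ k / (k.factorial : ℚ)
        * x ^ (r + 1 - k) / ((r + 1 - k).factorial : ℚ)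
      + (-1) ^ (r + 1) * (r.factorial : ℚ) * (-1) ^ k * bernoulli k / (k.factorial : ℚ)
        * ((2 ^ ((k : ℤ) - 1) - 1) / 2 ^ ((k : ℤ) - 1))
        * (N : ℚ) ^ (r + 1 - k) / ((r + 2 - k).factorial : ℚ))

/-- The factor `1 - 2^{1-k}` kills `B_1`, so `B_k` may be replaced by `(-1)^k B_k` next to it. -/
theorem neg_one_pow_mul_bernoulli_mul_two_zpow_sub_one (k : ℕ) :
    (-1) ^ k * bernoulli k * (((2 : ℚ) ^ ((k : ℤ) - 1) - 1) / 2 ^ ((k : ℤ) - 1))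
      = bernoulli k * (1 - 2 / 2 ^ k) := by
  have hfac : ((2 : ℚ) ^ ((k : ℤ) - 1) - 1) / 2 ^ ((k : ℤ) - 1) = 1 - 2 / 2 ^ k := by
    rw [zpow_sub_one₀ two_ne_zero, zpow_natCast]
    field_simp
  rw [hfac]
  rcases Nat.even_or_odd k with hk | hk
  · rw [hk.neg_one_pow, one_mul]
  · obtain rfl | hk1 := eq_or_ne k 1
    · norm_num
    · have hlt : 1 < k := by have := hk.pos; omega
      rw [bernoulli_eq_zero_of_odd hk hlt]
      simp

/-- Sums of powers over even and odd numbers: the odd ones, halved. -/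
theorem sum_range_add_half_pow (n p : ℕ) :
    ∑ j ∈ Finset.range n, ((j : ℚ) + 1 / 2) ^ p
      = (∑ j ∈ Finset.range (2 * n), (j : ℚ) ^ p) / 2 ^ p
        - ∑ j ∈ Finset.range n, (j : ℚ) ^ p := by
  induction n with
  | zero => simp
  | succ n ih =>
    have h2 : (2 : ℚ) ^ p ≠ 0 := by positivity
    have hodd : ((n : ℚ) + 1 / 2) ^ p = (2 * (n : ℚ) + 1) ^ p / 2 ^ p := by
      rw [← div_pow]
      congr 1
      ring
    rw [mul_add_one, Finset.sum_range_succ, ih, Finset.sum_range_succ _ (2 * n + 1),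
      Finset.sum_range_succ _ (2 * n), Finset.sum_range_succ _ n, hodd]
    push_cast
    rw [mul_pow]
    field_simp
    ring

/-- Faulhaber's formula for half-integers. -/
theorem sum_range_add_half_pow_eq_bernoulli (n p : ℕ) :
    ∑ j ∈ Finset.range n, ((j : ℚ) + 1 / 2) ^ p
      = -∑ k ∈ Finset.range (p + 1),
          bernoulli k * (1 - 2 / 2 ^ k) * ((p + 1).choose k) * (n : ℚ) ^ (p + 1 - k) / (p + 1) := by
  rw [sum_range_add_half_pow, sum_range_pow, sum_range_pow, Finset.sum_div,
    ← Finset.sum_sub_distrib, ← Finset.sum_neg_distrib]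
  refine Finset.sum_congr rfl fun k hk => ?_
  have hkp : k ≤ p + 1 := (Finset.mem_range.mp hk).le
  have hpow : (2 : ℚ) ^ (p + 1 - k) = 2 ^ p * (2 / 2 ^ k) := by
    rw [pow_sub₀ _ two_ne_zero hkp, pow_succ]
    ring
  push_cast
  rw [mul_pow, hpow]
  field_simp
  ring

/-- The non-constant part of `Apoly` is a binomial expansion. -/
theorem sum_factorial_mul_pow_div (r : ℕ) (a x : ℚ) :
    ∑ k ∈ Finset.range (r + 2),
        (r.factorial : ℚ) * a ^ k / (k.factorial : ℚ) * x ^ (r + 1 - k)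
          / ((r + 1 - k).factorial : ℚ)
      = (a + x) ^ (r + 1) / (r + 1) := by
  rw [add_pow, Finset.sum_div]
  refine Finset.sum_congr rfl fun k hk => ?_
  rw [Nat.cast_choose ℚ (Nat.lt_succ_iff.mp (Finset.mem_range.mp hk)), Nat.factorial_succ]
  push_cast
  field_simp

theorem mul_sum_bernoulli_eq_neg_sum_half_sub_pow (r N : ℕ) :
    (N : ℚ) * ∑ k ∈ Finset.range (r + 2),
        (-1) ^ (r + 1) * (r.factorial : ℚ) * (-1) ^ k * bernoulli k / (k.factorial : ℚ)
          * ((2 ^ ((k : ℤ) - 1) - 1) / 2 ^ ((k : ℤ) - 1))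
          * (N : ℚ) ^ (r + 1 - k) / ((r + 2 - k).factorial : ℚ)
      = -(∑ i ∈ Finset.Icc 1 N, (1 / 2 - (i : ℚ)) ^ (r + 1)) / (r + 1) := by
  have hsum : ∑ i ∈ Finset.Icc 1 N, (1 / 2 - (i : ℚ)) ^ (r + 1)
      = (-1) ^ (r + 1) * ∑ j ∈ Finset.range N, ((j : ℚ) + 1 / 2) ^ (r + 1) := by
    rw [← Finset.Ico_add_one_right_eq_Icc, Finset.sum_Ico_eq_sum_range, Finset.mul_sum]
    refine Finset.sum_congr (by simp) fun j _ => ?_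
    rw [← mul_pow]
    push_cast
    congr 1
    ring
  rw [hsum, sum_range_add_half_pow_eq_bernoulli, mul_neg, neg_neg, Finset.mul_sum,
    Finset.mul_sum, Finset.sum_div]
  refine Finset.sum_congr rfl fun k hk => ?_
  have hk' : k ≤ r + 1 := Nat.lt_succ_iff.mp (Finset.mem_range.mp hk)
  have hN : (N : ℚ) ^ (r + 1 + 1 - k) = N * (N : ℚ) ^ (r + 1 - k) := by
    rw [Nat.succ_sub hk', pow_succ']
  rw [← neg_one_pow_mul_bernoulli_mul_two_zpow_sub_one, hN,
    Nat.cast_choose ℚ (hk'.trans (Nat.le_succ _)), Nat.factorial_succ (r + 1),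
    Nat.factorial_succ r]
  generalize ((2 : ℚ) ^ ((k : ℤ) - 1) - 1) / 2 ^ ((k : ℤ) - 1) = c
  have h1 : (r : ℚ) + 1 ≠ 0 := by positivity
  have h2 : (r : ℚ) + 1 + 1 ≠ 0 := by positivity
  push_cast
  field_simp

/-- Sections 5.2–5.3: for a partition `λ₁ ≥ ⋯ ≥ λ_N ≥ 0` with `h_i = λ_i - i + N`, the
polynomial `A_{r+1}` satisfies `∑_{i=1}^N A_{r+1}(h_i) = 𝐩_{r+1}(λ)/(r+1)`, where
`𝐩_{r+1}(λ) = ∑_{i=1}^N [(λ_i - i + 1/2)^{r+1} - (1/2 - i)^{r+1}]`. -/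
theorem sum_Apoly_eq_shifted_power_sum (r N : ℕ) (hr : 1 ≤ r) (hN : 1 ≤ N)
    (lam : ℕ → ℕ) (hanti : ∀ i j, 1 ≤ i → i ≤ j → j ≤ N → lam j ≤ lam i) :
    ∑ i ∈ Finset.Icc 1 N, Apoly r N ((lam i : ℚ) - (i : ℚ) + (N : ℚ))
      = (∑ i ∈ Finset.Icc 1 N,
          (((lam i : ℚ) - (i : ℚ) + 1 / 2) ^ (r + 1) - (1 / 2 - (i : ℚ)) ^ (r + 1)))
        / ((r : ℚ) + 1) := by
  simp only [Apoly, Finset.sum_add_distrib (s := Finset.range (r + 2)),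
    sum_factorial_mul_pow_div]
  rw [Finset.sum_add_distrib, Finset.sum_const, Nat.card_Icc, Nat.add_sub_cancel, nsmul_eq_mul,
    mul_sum_bernoulli_eq_neg_sum_half_sub_pow, ← Finset.sum_div, ← add_div, ← sub_eq_add_neg,
    Finset.sum_sub_distrib]
  congr 2
  refine Finset.sum_congr rfl fun i _ => ?_
  congr 1
  ring
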